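/- arXiv:1412.7376 — 3 statements merged into one kernel-verified Lean document; each statement's English description precedes it below -/
import Mathlib

section
/- Let λ₁,…,λ_N be pairwise distinct complex numbers and Θ a smooth function of x₁,…,x_N. If for some λ not equal to any λ_i, the 2-form Ω = Σ_{i<j} (1/(λ−λ_i) − 1/(λ−λ_j)) Θ_{,ij} dx_i ∧ dx_j satisfies Ω ∧ Ω = 0, then for the indices appearing, (λ_k−λ_j)(λ_l−λ_i)Θ_{,jk}Θ_{,il} − (λ_k−λ_i)(λ_l−λ_j)Θ_{,ik}Θ_{,jl} + (λ_j−λ_i)(λ_l−λ_k)Θ_{,ij}Θ_{,kl} = 0 holds for every choice of four distinct indices i,j,k,l, provided Ω ∧ Ω = 0 for all λ outside {λ₁,…,λ_N}. -/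
/-- Second mixed partial derivative `Θ_{,ij}` of a function on `ℝ^N` at a point. -/
noncomputable def D2 {N : ℕ} (Θ : (Fin N → ℝ) → ℂ) (x : Fin N → ℝ) (i j : Fin N) : ℂ :=
  fderiv ℝ (fun y => fderiv ℝ Θ y (Pi.single j 1)) x (Pi.single i 1)

/-- The differential `dx i` in the exterior algebra of `ℂ^N`. -/
noncomputable def dxN {N : ℕ} (i : Fin N) : ExteriorAlgebra ℂ (Fin N → ℂ) :=
  ExteriorAlgebra.ι ℂ (Pi.single i 1)

open Finset in
/-- An antisymmetric 2-form, written with a sum over ordered pairs, doubles to the full sum. -/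
theorem two_smul_sum_lt_eq_sum {N : ℕ} (A : Fin N → Fin N → ℂ) (hA : ∀ p q, A p q = -A q p) :
    (2 : ℂ) • (∑ p : Fin N, ∑ q : Fin N,
        if p < q then A p q • (dxN p * dxN q : ExteriorAlgebra ℂ (Fin N → ℂ)) else 0) =
      ∑ p : Fin N, ∑ q : Fin N, A p q • (dxN p * dxN q) := by
  have hsymm (p q : Fin N) : A q p • (dxN q * dxN p : ExteriorAlgebra ℂ (Fin N → ℂ)) =
      A p q • (dxN p * dxN q) := by
    have h : (dxN q * dxN p : ExteriorAlgebra ℂ (Fin N → ℂ)) = -(dxN p * dxN q) :=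
      eq_neg_of_add_eq_zero_left (ExteriorAlgebra.ι_add_mul_swap _ _)
    rw [h, hA q p, smul_neg, neg_smul, neg_neg]
  have hsplit (p q : Fin N) : A p q • (dxN p * dxN q : ExteriorAlgebra ℂ (Fin N → ℂ)) =
      (if p < q then A p q • (dxN p * dxN q) else 0) +
        (if q < p then A q p • (dxN q * dxN p) else 0) := by
    rcases lt_trichotomy p q with h | rfl | h
    · simp [h, h.not_gt]
    · have : A p p = 0 := self_eq_neg.mp (hA p p)
      simp [this]
    · simp [h, h.not_gt, hsymm p q]
  rw [sum_congr rfl fun p _ => sum_congr rfl fun q _ => hsplit p q, two_smul]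
  simp only [sum_add_distrib]
  congr 1
  exact sum_comm

/-- The coefficient functional of `dx (σ 0) ∧ dx (σ 1) ∧ dx (σ 2) ∧ dx (σ 3)`. -/
noncomputable def coeffFour {N : ℕ} (σ : Fin 4 → Fin N) :
    ExteriorAlgebra ℂ (Fin N → ℂ) →ₗ[ℂ] ℂ :=
  ExteriorAlgebra.liftAlternating (Function.update (fun _ => 0) 4
    (Matrix.detRowAlternating.compLinearMap (LinearMap.funLeft ℂ ℂ σ)))

theorem coeffFour_dxN {N : ℕ} (σ : Fin 4 → Fin N) (p q r s : Fin N) :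
    coeffFour σ (dxN p * dxN q * (dxN r * dxN s)) =
      Matrix.det (Matrix.of fun a b : Fin 4 =>
        ![Pi.single p 1, Pi.single q 1, Pi.single r 1, (Pi.single s 1 : Fin N → ℂ)] a (σ b)) := by
  have h : (dxN p * dxN q * (dxN r * dxN s) : ExteriorAlgebra ℂ (Fin N → ℂ)) =
      ExteriorAlgebra.ιMulti ℂ 4 (fun a => Pi.single (![p, q, r, s] a) 1) := by
    simp [ExteriorAlgebra.ιMulti_apply, dxN, mul_assoc, Matrix.vecTail]
  rw [h, coeffFour, ExteriorAlgebra.liftAlternating_apply_ιMulti, Function.update_self]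
  rw [AlternatingMap.compLinearMap_apply]
  refine congrArg Matrix.det ?_
  ext a b
  fin_cases a <;> simp [LinearMap.funLeft_apply]

open Finset in
/-- The Plücker relations for a decomposable antisymmetric 2-form. -/
theorem pluecker_of_mul_self_eq_zero {N : ℕ} (A : Fin N → Fin N → ℂ)
    (hA : ∀ p q, A p q = -A q p)
    (h : (∑ p : Fin N, ∑ q : Fin N,
        if p < q then A p q • (dxN p * dxN q : ExteriorAlgebra ℂ (Fin N → ℂ)) else 0) *
      (∑ p : Fin N, ∑ q : Fin N, if p < q then A p q • (dxN p * dxN q) else 0) = 0)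
    (i j k m : Fin N) :
    A i j * A k m - A i k * A j m + A i m * A j k = 0 := by
  have hS : (∑ p : Fin N, ∑ q : Fin N,
        A p q • (dxN p * dxN q : ExteriorAlgebra ℂ (Fin N → ℂ))) *
      (∑ p : Fin N, ∑ q : Fin N, A p q • (dxN p * dxN q)) = 0 := by
    rw [← two_smul_sum_lt_eq_sum A hA, smul_mul_smul_comm, h, smul_zero]
  have hc := congrArg (coeffFour ![i, j, k, m]) hS
  simp only [sum_mul, mul_sum, smul_mul_smul_comm, map_sum, map_smul, map_zero,
    coeffFour_dxN, smul_eq_mul] at hc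
  simp [Matrix.det_succ_row_zero, Fin.sum_univ_succ, Fin.succAbove, mul_add, sum_add_distrib,
    Pi.single_apply] at hc
  rw [hA j i, hA k i, hA m i, hA k j, hA m j, hA m k] at hc
  linear_combination hc / 8

theorem D2_comm {N : ℕ} {Θ : (Fin N → ℝ) → ℂ} (hΘ : ContDiff ℝ (⊤ : ℕ∞) Θ)
    (x : Fin N → ℝ) (i j : Fin N) : D2 Θ x i j = D2 Θ x j i := by
  have hd : DifferentiableAt ℝ (fderiv ℝ Θ) x :=
    ((hΘ.fderiv_right (m := 1) (by norm_cast)).differentiable (by norm_num)).differentiableAt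
  have hs : IsSymmSndFDerivAt ℝ Θ x :=
    hΘ.contDiffAt.isSymmSndFDerivAt (by simp; norm_cast)
  have h (v w : Fin N → ℝ) :
      fderiv ℝ (fun y => fderiv ℝ Θ y v) x w = fderiv ℝ (fderiv ℝ Θ) x w v := by
    rw [fderiv_clm_apply hd (differentiableAt_const v)]
    simp
  rw [D2, D2, h, h]
  exact hs _ _

/-- If the λ-dependent 2-form `Ω = Σ_{i<j} (1/(λ−λ_i) − 1/(λ−λ_j)) Θ_{,ij} dx_i ∧ dx_j`
satisfies `Ω ∧ Ω = 0` for all λ outside the poles, then `Θ` satisfies the general heavenly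
equation for every choice of four distinct indices. -/
theorem stmt5 {N : ℕ} (l : Fin N → ℂ) (hl : Function.Injective l)
    (Θ : (Fin N → ℝ) → ℂ) (hΘ : ContDiff ℝ (⊤ : ℕ∞) Θ)
    (hΩ : ∀ x : Fin N → ℝ, ∀ lam : ℂ, (∀ i, lam ≠ l i) →
      (∑ i : Fin N, ∑ j : Fin N, if i < j then
          ((1/(lam - l i) - 1/(lam - l j)) * D2 Θ x i j) • (dxN i * dxN j) else 0) *
      (∑ i : Fin N, ∑ j : Fin N, if i < j then
          ((1/(lam - l i) - 1/(lam - l j)) * D2 Θ x i j) • (dxN i * dxN j) else 0) = 0) :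
    ∀ x : Fin N → ℝ, ∀ i j k m : Fin N,
      i ≠ j → i ≠ k → i ≠ m → j ≠ k → j ≠ m → k ≠ m →
      (l k - l j) * (l m - l i) * D2 Θ x j k * D2 Θ x i m -
      (l k - l i) * (l m - l j) * D2 Θ x i k * D2 Θ x j m +
      (l j - l i) * (l m - l k) * D2 Θ x i j * D2 Θ x k m = 0 := by
  intro x i j k m _ _ _ _ _ _
  obtain ⟨lam, hlam⟩ := (Set.finite_range l).exists_notMem
  have hne (p : Fin N) : lam - l p ≠ 0 := fun h => hlam ⟨p, (sub_eq_zero.mp h).symm⟩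
  have hP := pluecker_of_mul_self_eq_zero
    (fun p q => (1 / (lam - l p) - 1 / (lam - l q)) * D2 Θ x p q)
    (fun p q => by rw [D2_comm hΘ x p q]; ring)
    (hΩ x lam fun p => sub_ne_zero.mp (hne p)) i j k m
  have hi := hne i
  have hj := hne j
  have hk := hne k
  have hm := hne m
  have hdiff {p q : Fin N} (hp : lam - l p ≠ 0) (hq : lam - l q ≠ 0) :
      1 / (lam - l p) - 1 / (lam - l q) = (l p - l q) * ((lam - l p)⁻¹ * (lam - l q)⁻¹) := by
    field_simp
    ring
  simp only [hdiff, hi, hj, hk, hm, ne_eq, not_false_eq_true] at hP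
  have hprod : (lam - l i)⁻¹ * (lam - l j)⁻¹ * (lam - l k)⁻¹ * (lam - l m)⁻¹ ≠ 0 := by
    simp [hi, hj, hk, hm]
  refine (mul_eq_zero.mp ?_).resolve_left hprod
  linear_combination hP
end

section
/- Let U ⊆ ℝ⁴ be open and convex, and let w_{ij} = w_{ji} (1 ≤ i < j ≤ 4) be smooth functions on U satisfying ∂_k w_{ij} = ∂_j w_{ik} for all distinct i, j, k. Then there exists a smooth function Θ on U such that w_{ij} = ∂_i∂_j Θ for all i ≠ j. -/
/-- Partial derivative `∂_k f` of a function on `ℝ⁴` at a point. -/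
noncomputable def pd (k : Fin 4) (f : (Fin 4 → ℝ) → ℝ) (x : Fin 4 → ℝ) : ℝ :=
  fderiv ℝ f x (Pi.single k 1)

open scoped ContDiff Manifold Topology

section ParametricIntegral

variable {E G : Type} [NormedAddCommGroup E] [NormedSpace ℝ E]
  [NormedAddCommGroup G] [NormedSpace ℝ G]

/-- Differentiation under the integral sign over the compact interval `[0, 1]`, for an integrand
that is jointly `C^1` near `{x} × [0, 1]`. -/
theorem hasFDerivAt_integral_unitInterval {f : E × ℝ → G} {x : E}
    (hf : ∀ t ∈ Set.Icc (0 : ℝ) 1, ContDiffAt ℝ 1 f (x, t)) :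
    HasFDerivAt (fun y => ∫ t in (0 : ℝ)..1, f (y, t))
      (∫ t in (0 : ℝ)..1, (fderiv ℝ f (x, t)).comp (ContinuousLinearMap.inl ℝ E ℝ)) x := by
  have hmk (y : E) : Continuous fun t : ℝ => (y, t) := by fun_prop
  have hcont {y : E} (hy : ∀ t ∈ Set.Icc (0 : ℝ) 1, ContDiffAt ℝ 1 f (y, t)) :
      ContinuousOn (fun t => f (y, t)) (Set.Icc 0 1) := fun t ht =>
    ((hy t ht).continuousAt.comp (f := fun t : ℝ => (y, t))
      (hmk y).continuousAt).continuousWithinAt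
  have hcont' : ContinuousOn
      (fun t => (fderiv ℝ f (x, t)).comp (ContinuousLinearMap.inl ℝ E ℝ)) (Set.Icc 0 1) := by
    intro t ht
    have h : ContinuousAt (fderiv ℝ f) (x, t) :=
      ((hf t ht).fderiv_right (m := 0) (by norm_num)).continuousAt
    have h' : ContinuousAt (fun t => fderiv ℝ f (x, t)) t :=
      h.comp (f := fun t : ℝ => (x, t)) (hmk x).continuousAt
    exact (h'.clm_comp continuousAt_const).continuousWithinAt
  have hIoc : Set.uIoc (0 : ℝ) 1 ⊆ Set.Icc 0 1 := by
    rw [Set.uIoc_of_le zero_le_one]; exact Set.Ioc_subset_Icc_self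
  have huIcc : Set.uIcc (0 : ℝ) 1 = Set.Icc 0 1 := Set.uIcc_of_le zero_le_one
  obtain ⟨C, hC⟩ := isCompact_Icc.exists_bound_of_continuousOn hcont'
  have hnear : ∀ᶠ y in 𝓝 x, ∀ t ∈ Set.Icc (0 : ℝ) 1, ContDiffAt ℝ 1 f (y, t) ∧
      ‖(fderiv ℝ f (y, t)).comp (ContinuousLinearMap.inl ℝ E ℝ)‖ < C + 1 := by
    refine isCompact_Icc.eventually_forall_of_forall_eventually fun t ht => ?_
    have h : ContinuousAt (fun p => (fderiv ℝ f p).comp (ContinuousLinearMap.inl ℝ E ℝ)) (x, t) :=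
      ((hf t ht).fderiv_right (m := 0) (by norm_num)).continuousAt.clm_comp continuousAt_const
    exact ((hf t ht).eventually (by simp)).and
      (h.norm.eventually_lt continuousAt_const ((hC t ht).trans_lt (lt_add_one C)))
  refine intervalIntegral.hasFDerivAt_integral_of_dominated_of_fderiv_le
    (F := fun y t => f (y, t))
    (F' := fun y t => (fderiv ℝ f (y, t)).comp (ContinuousLinearMap.inl ℝ E ℝ))
    (bound := fun _ => C + 1) hnear ?_ ?_ ?_ ?_ ?_ ?_
  · filter_upwards [hnear] with y hy
    exact ((hcont fun t ht => (hy t ht).1).mono hIoc).aestronglyMeasurable measurableSet_uIoc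
  · exact (huIcc ▸ hcont hf).intervalIntegrable
  · exact (hcont'.mono hIoc).aestronglyMeasurable measurableSet_uIoc
  · exact Filter.Eventually.of_forall fun t ht y hy => (hy t (hIoc ht)).2.le
  · exact intervalIntegrable_const
  · refine Filter.Eventually.of_forall fun t ht y hy => ?_
    exact ((hy t (hIoc ht)).1.differentiableAt (by simp)).hasFDerivAt.comp y
      (hasFDerivAt_prodMk_left y t)

theorem contDiffOn_integral_unitInterval {U : Set E} (hU : IsOpen U) {f : E × ℝ → G}
    (hf : ∀ x ∈ U, ∀ t ∈ Set.Icc (0 : ℝ) 1, ContDiffAt ℝ ∞ f (x, t)) :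
    ContDiffOn ℝ ∞ (fun x => ∫ t in (0 : ℝ)..1, f (x, t)) U := by
  rw [contDiffOn_infty]
  intro n
  induction n generalizing G with
  | zero =>
    refine contDiffOn_zero.2 fun x hx => ?_
    exact (hasFDerivAt_integral_unitInterval fun t ht =>
      (hf x hx t ht).of_le (by simp)).continuousAt.continuousWithinAt
  | succ n ih =>
    have hd : ∀ x ∈ U, HasFDerivAt (fun y => ∫ t in (0 : ℝ)..1, f (y, t))
        (∫ t in (0 : ℝ)..1, (fderiv ℝ f (x, t)).comp (ContinuousLinearMap.inl ℝ E ℝ)) x :=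
      fun x hx => hasFDerivAt_integral_unitInterval fun t ht => (hf x hx t ht).of_le (by simp)
    push_cast
    refine (contDiffOn_succ_iff_fderiv_of_isOpen hU).2
      ⟨fun x hx => (hd x hx).differentiableAt.differentiableWithinAt, by simp, ?_⟩
    refine (ih (f := fun p => (fderiv ℝ f p).comp (ContinuousLinearMap.inl ℝ E ℝ))
      fun x hx t ht => ?_).congr fun x hx => (hd x hx).fderiv
    exact ((hf x hx t ht).fderiv_right (m := ∞) (by simp)).clm_comp contDiffAt_const

/-- Poincaré lemma along the slices of a convex set `U`: if `σ : U → U` is constant along the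
directions in a subspace `V`, the point `x` is reached from `σ x` by a vector in `V`, and the
`1`-form `η` is closed along `V`, then `η` has a smooth primitive along `V`. -/
theorem exists_primitive_along_submodule {U : Set E} (hUo : IsOpen U) (hUc : Convex ℝ U)
    (V : Submodule ℝ E) {σ : E → E} (hσ : ContDiffOn ℝ ∞ σ U) (hσU : ∀ x ∈ U, σ x ∈ U)
    (hσV : ∀ x ∈ U, x - σ x ∈ V) (hσ' : ∀ x ∈ U, ∀ v ∈ V, fderiv ℝ σ x v = 0)
    {η : E → E →L[ℝ] ℝ} (hη : ContDiffOn ℝ ∞ η U)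
    (hclosed : ∀ x ∈ U, ∀ u ∈ V, ∀ v ∈ V, fderiv ℝ η x u v = fderiv ℝ η x v u) :
    ∃ A : E → ℝ, ContDiffOn ℝ ∞ A U ∧ ∀ x ∈ U, ∀ v ∈ V, fderiv ℝ A x v = η x v := by
  let γ : E × ℝ → E := fun p => σ p.1 + p.2 • (p.1 - σ p.1)
  let f : E × ℝ → ℝ := fun p => η (γ p) (p.1 - σ p.1)
  have hγU : ∀ x ∈ U, ∀ t ∈ Set.Icc (0 : ℝ) 1, γ (x, t) ∈ U := fun x hx t ht =>
    hUc.add_smul_sub_mem (hσU x hx) hx ht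
  have hσat : ∀ x ∈ U, ContDiffAt ℝ ∞ σ x := fun x hx => hσ.contDiffAt (hUo.mem_nhds hx)
  have hηat : ∀ x ∈ U, ContDiffAt ℝ ∞ η x := fun x hx => hη.contDiffAt (hUo.mem_nhds hx)
  have hf : ∀ x ∈ U, ∀ t ∈ Set.Icc (0 : ℝ) 1, ContDiffAt ℝ ∞ f (x, t) := by
    intro x hx t ht
    have h1 : ContDiffAt ℝ ∞ (fun p : E × ℝ => σ p.1) (x, t) :=
      (hσat x hx).comp (x, t) contDiffAt_fst
    have h2 : ContDiffAt ℝ ∞ (fun p : E × ℝ => p.1 - σ p.1) (x, t) := contDiffAt_fst.sub h1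
    have h3 : ContDiffAt ℝ ∞ γ (x, t) := h1.add (contDiffAt_snd.smul h2)
    exact ((hηat _ (hγU x hx t ht)).comp (x, t) h3).clm_apply h2
  refine ⟨fun x => ∫ t in (0 : ℝ)..1, f (x, t), contDiffOn_integral_unitInterval hUo hf,
    fun x hx v hv => ?_⟩
  have huIcc : Set.uIcc (0 : ℝ) 1 = Set.Icc 0 1 := Set.uIcc_of_le zero_le_one
  have hint : ContinuousOn
      (fun t => (fderiv ℝ f (x, t)).comp (ContinuousLinearMap.inl ℝ E ℝ)) (Set.uIcc 0 1) := by
    intro t ht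
    have h : ContinuousAt (fderiv ℝ f) (x, t) :=
      ((hf x hx t (huIcc ▸ ht)).fderiv_right (m := 0) (by simp)).continuousAt
    have h' : ContinuousAt (fun t => fderiv ℝ f (x, t)) t :=
      h.comp (f := fun t : ℝ => (x, t)) (by fun_prop)
    exact (h'.clm_comp continuousAt_const).continuousWithinAt
  rw [(hasFDerivAt_integral_unitInterval fun t ht => (hf x hx t ht).of_le (by simp)).fderiv,
    ContinuousLinearMap.intervalIntegral_apply hint.intervalIntegrable]
  have hprim : ∀ t ∈ Set.uIcc (0 : ℝ) 1, HasDerivAt (fun t => t * η (γ (x, t)) v)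
      ((fderiv ℝ f (x, t)).comp (ContinuousLinearMap.inl ℝ E ℝ) v) t := by
    intro t ht
    rw [huIcc] at ht
    have hηd : HasFDerivAt η (fderiv ℝ η (γ (x, t))) (γ (x, t)) :=
      ((hηat _ (hγU x hx t ht)).differentiableAt (by simp)).hasFDerivAt
    have hσd : HasFDerivAt σ (fderiv ℝ σ x) x :=
      ((hσat x hx).differentiableAt (by simp)).hasFDerivAt
    have hslice : HasFDerivAt (fun y => f (y, t))
        ((fderiv ℝ f (x, t)).comp (ContinuousLinearMap.inl ℝ E ℝ)) x :=
      HasFDerivAt.comp (g := f) (f := fun y => (y, t)) x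
        ((hf x hx t ht).differentiableAt (by simp)).hasFDerivAt (hasFDerivAt_prodMk_left x t)
    have hsub := (hasFDerivAt_id x).sub hσd
    have hγx : HasFDerivAt (fun y => γ (y, t)) _ x := hσd.add (hsub.const_smul t)
    have hslice' : HasFDerivAt (fun y => f (y, t)) _ x :=
      (HasFDerivAt.comp (g := η) (f := fun y => γ (y, t)) x hηd hγx).clm_apply hsub
    have hγt : HasDerivAt (fun t => γ (x, t)) ((1 : ℝ) • (x - σ x)) t :=
      ((hasDerivAt_id t).smul_const (x - σ x)).const_add (σ x)
    have hηt : HasDerivAt (fun t => η (γ (x, t)) v)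
        (fderiv ℝ η (γ (x, t)) ((1 : ℝ) • (x - σ x)) v) t := by
      have h := HasFDerivAt.comp_hasDerivAt (f := fun t => γ (x, t)) t hηd hγt
      simpa using h.clm_apply (hasDerivAt_const t v)
    refine ((hasDerivAt_id t).mul hηt).congr_deriv ?_
    rw [hslice.unique hslice']
    have hsymm := hclosed _ (hγU x hx t ht) v hv _ (hσV x hx)
    simp only [map_sub, sub_apply] at hsymm
    simp [hσ' x hx v hv, hsymm]
  rw [intervalIntegral.integral_eq_sub_of_hasDerivAt hprim
    (hint.clm_apply continuousOn_const).intervalIntegrable]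
  simp [γ]

end ParametricIntegral

section Coordinates

variable {ι : Type} [Fintype ι]

theorem contDiffOn_sum_smul_proj {U : Set (ι → ℝ)} {a : ι → (ι → ℝ) → ℝ}
    (ha : ∀ j, ContDiffOn ℝ ∞ (a j) U) :
    ContDiffOn ℝ ∞
      (fun x => ∑ j, a j x • (ContinuousLinearMap.proj j : (ι → ℝ) →L[ℝ] ℝ)) U :=
  ContDiffOn.sum fun j _ => (ha j).smul contDiffOn_const

variable [DecidableEq ι]

/-- Over an open convex set, the fibres of a coordinate projection admit a smoothly varying choice
of base points. -/
theorem exists_contDiffOn_slice_section {U : Set (ι → ℝ)} (hUo : IsOpen U) (hUc : Convex ℝ U)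
    (i : ι) :
    ∃ s : ℝ → ι → ℝ, ∀ x ∈ U,
      ContDiffAt ℝ ∞ s (x i) ∧ Function.update (s (x i)) i (x i) ∈ U := by
  let M : TopologicalSpace.Opens ℝ :=
    ⟨(fun x : ι → ℝ => x i) '' U, isOpenMap_eval i U hUo⟩
  let t : M → Set (ι → ℝ) := fun r => {y | Function.update y i (r : ℝ) ∈ U}
  have ht : ∀ r, Convex ℝ (t r) := by
    intro r y hy z hz a b ha hb hab
    have h := hUc hy hz ha hb hab
    change Function.update (a • y + b • z) i (r : ℝ) ∈ U
    convert h using 1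
    ext j
    rcases eq_or_ne j i with rfl | hj
    · simp [← add_mul, hab]
    · simp [hj]
  have hloc : ∀ r, ∃ c, ∀ᶠ r' in 𝓝 r, c ∈ t r' := by
    rintro ⟨r, x, hx, rfl⟩
    refine ⟨x, ?_⟩
    have hc : Continuous fun r' : M => Function.update x i (r' : ℝ) :=
      continuous_const.update i continuous_subtype_val
    refine hc.continuousAt.eventually (hUo.mem_nhds ?_)
    simpa using hx
  have : LocallyCompactSpace M := M.isOpen.locallyCompactSpace
  have : SigmaCompactSpace M := sigmaCompactSpace_of_locallyCompact_secondCountable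
  obtain ⟨g, hg⟩ := exists_contMDiffMap_forall_mem_convex_of_local_const
    (n := ⊤) 𝓘(ℝ, ℝ) ht hloc
  classical
  let s : ℝ → ι → ℝ := fun r => if h : r ∈ M then g ⟨r, h⟩ else 0
  have hs (r : M) : s r = g r := by simp [s]
  refine ⟨s, fun x hx => ?_⟩
  let r : M := ⟨x i, x, hx, rfl⟩
  constructor
  · have h : ContMDiffAt 𝓘(ℝ, ℝ) 𝓘(ℝ, ι → ℝ) ∞ (fun r : M => s r) r := by
      simp only [hs]
      exact g.contMDiff r
    exact (contMDiffAt_subtype_iff.1 h).contDiffAt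
  · have h := hg r
    rw [← hs] at h
    exact h

theorem fderiv_apply_eq_sum_single {f : (ι → ℝ) → ℝ} (x u : ι → ℝ) :
    fderiv ℝ f x u = ∑ k, u k * fderiv ℝ f x (Pi.single k 1) := by
  conv_lhs => rw [pi_eq_sum_univ' u]
  simp [map_sum]

/-- Closedness in coordinates of a `1`-form, along the directions in `S`. -/
theorem fderiv_sum_smul_proj_symm {a : ι → (ι → ℝ) → ℝ} {x : ι → ℝ}
    (ha : ∀ j, DifferentiableAt ℝ (a j) x) (S : Set ι)
    (h : ∀ j ∈ S, ∀ k ∈ S,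
      fderiv ℝ (a j) x (Pi.single k 1) = fderiv ℝ (a k) x (Pi.single j 1))
    {u v : ι → ℝ} (hu : ∀ j ∉ S, u j = 0) (hv : ∀ j ∉ S, v j = 0) :
    fderiv ℝ (fun x => ∑ j, a j x • (ContinuousLinearMap.proj j : (ι → ℝ) →L[ℝ] ℝ)) x u v =
      fderiv ℝ (fun x => ∑ j, a j x • (ContinuousLinearMap.proj j : (ι → ℝ) →L[ℝ] ℝ)) x v u := by
  have hd (u v : ι → ℝ) :
      fderiv ℝ (fun x => ∑ j, a j x • (ContinuousLinearMap.proj j : (ι → ℝ) →L[ℝ] ℝ)) x u v =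
        ∑ j, ∑ k, u k * v j * fderiv ℝ (a j) x (Pi.single k 1) := by
    have h1 := HasFDerivAt.fun_sum (u := Finset.univ) fun j _ => (ha j).hasFDerivAt.smul_const
      (ContinuousLinearMap.proj j : (ι → ℝ) →L[ℝ] ℝ)
    rw [h1.fderiv]
    simp only [sum_apply, ContinuousLinearMap.smulRight_apply,
      smul_apply, ContinuousLinearMap.proj_apply, smul_eq_mul]
    refine Finset.sum_congr rfl fun j _ => ?_
    rw [fderiv_apply_eq_sum_single, Finset.sum_mul]
    exact Finset.sum_congr rfl fun k _ => by ring
  rw [hd, hd, Finset.sum_comm]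
  refine Finset.sum_congr rfl fun k _ => Finset.sum_congr rfl fun j _ => ?_
  by_cases hk : k ∈ S
  · by_cases hj : j ∈ S
    · rw [h j hj k hk]; ring
    · simp [hv j hj]
  · simp [hu k hk]

/-- Functions `a j` that are compatible in all directions `j ≠ i` are the partial derivatives of a
single smooth function in these directions. -/
theorem exists_primitive_off_coordinate {U : Set (ι → ℝ)} (hUo : IsOpen U) (hUc : Convex ℝ U)
    (i : ι) {a : ι → (ι → ℝ) → ℝ} (ha : ∀ j, ContDiffOn ℝ ∞ (a j) U)
    (h : ∀ x ∈ U, ∀ j ≠ i, ∀ k ≠ i,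
      fderiv ℝ (a j) x (Pi.single k 1) = fderiv ℝ (a k) x (Pi.single j 1)) :
    ∃ A : (ι → ℝ) → ℝ, ContDiffOn ℝ ∞ A U ∧
      ∀ x ∈ U, ∀ j ≠ i, fderiv ℝ A x (Pi.single j 1) = a j x := by
  obtain ⟨s, hs⟩ := exists_contDiffOn_slice_section hUo hUc i
  let V : Submodule ℝ (ι → ℝ) := LinearMap.ker (LinearMap.proj i : (ι → ℝ) →ₗ[ℝ] ℝ)
  have hV (v : ι → ℝ) : v ∈ V ↔ v i = 0 := by simp [V]
  have hsupp {v : ι → ℝ} (hv : v ∈ V) : ∀ j ∉ {j | j ≠ i}, v j = 0 := by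
    intro j hj
    obtain rfl : j = i := by simpa using hj
    exact (hV v).1 hv
  let τ : ℝ → ι → ℝ := fun r => Function.update (s r) i r
  have hτ : ∀ x ∈ U, ContDiffAt ℝ ∞ τ (x i) := by
    intro x hx
    refine contDiffAt_pi.2 fun j => ?_
    rcases eq_or_ne j i with rfl | hj
    · simpa [τ] using contDiffAt_fun_id
    · simpa [τ, hj] using contDiffAt_pi.1 (hs x hx).1 j
  have hproj (x : ι → ℝ) : ContDiffAt ℝ ∞ (fun y : ι → ℝ => y i) x := contDiffAt_apply ..
  obtain ⟨A, hA, hA'⟩ := exists_primitive_along_submodule hUo hUc V (σ := fun x => τ (x i))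
    (fun x hx => (ContDiffAt.comp (g := τ) (f := fun y : ι → ℝ => y i) x
      (hτ x hx) (hproj x)).contDiffWithinAt)
    (fun x hx => (hs x hx).2) (fun x _ => by simp [hV, τ])
    (fun x hx v hv => by
      have h1 := (HasFDerivAt.comp (g := τ) (f := fun y : ι → ℝ => y i) x
        ((hτ x hx).differentiableAt (by simp)).hasFDerivAt (hasFDerivAt_apply i x)).fderiv
      have h2 := congrArg (fun L => L v) h1
      simpa [Function.comp_def, (hV v).1 hv] using h2)
    (contDiffOn_sum_smul_proj ha)
    (fun x hx u hu v hv => fderiv_sum_smul_proj_symm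
      (fun j => ((ha j).contDiffAt (hUo.mem_nhds hx)).differentiableAt (by simp))
      {j | j ≠ i} (h x hx) (hsupp hu) (hsupp hv))
  refine ⟨A, hA, fun x hx j hj => ?_⟩
  rw [hA' x hx _ ((hV _).2 (by simp [hj.symm]))]
  simp [Pi.single_apply]

/-- Poincaré lemma for `1`-forms in coordinates, with smoothness of the primitive. -/
theorem exists_contDiffOn_primitive {U : Set (ι → ℝ)} (hUo : IsOpen U) (hUc : Convex ℝ U)
    {a : ι → (ι → ℝ) → ℝ} (ha : ∀ j, ContDiffOn ℝ ∞ (a j) U)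
    (h : ∀ x ∈ U, ∀ j k,
      fderiv ℝ (a j) x (Pi.single k 1) = fderiv ℝ (a k) x (Pi.single j 1)) :
    ∃ A : (ι → ℝ) → ℝ, ContDiffOn ℝ ∞ A U ∧
      ∀ x ∈ U, ∀ j, fderiv ℝ A x (Pi.single j 1) = a j x := by
  have hη := contDiffOn_sum_smul_proj ha
  obtain ⟨A, hA⟩ := hUc.exists_forall_hasFDerivAt_of_fderiv_symmetric hUo
    (hη.differentiableOn (by simp))
    (fun x hx u v => fderiv_sum_smul_proj_symm
      (fun j => ((ha j).contDiffAt (hUo.mem_nhds hx)).differentiableAt (by simp))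
      Set.univ (fun j _ k _ => h x hx j k) (by simp) (by simp))
  refine ⟨A, (contDiffOn_infty_iff_fderiv_of_isOpen hUo).2
    ⟨fun x hx => (hA x hx).differentiableAt.differentiableWithinAt,
      hη.congr fun x hx => (hA x hx).fderiv⟩, fun x hx j => ?_⟩
  rw [(hA x hx).fderiv]
  simp [Pi.single_apply]

end Coordinates

/-- Existence of a potential: if the symmetric smooth coefficients `w_ij` on a convex open
set satisfy `∂_k w_ij = ∂_j w_ik` for all distinct `i,j,k`, then there is a smooth `Θ` with
`w_ij = ∂_i ∂_j Θ` for all `i ≠ j`. -/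
theorem stmt7 (U : Set (Fin 4 → ℝ)) (hUo : IsOpen U) (hUc : Convex ℝ U)
    (w : Fin 4 → Fin 4 → (Fin 4 → ℝ) → ℝ)
    (hsymm : ∀ i j, w i j = w j i)
    (hsmooth : ∀ i j, ContDiffOn ℝ (⊤ : ℕ∞) (w i j) U)
    (hcompat : ∀ i j k : Fin 4, i ≠ j → i ≠ k → j ≠ k →
      ∀ x ∈ U, pd k (w i j) x = pd j (w i k) x) :
    ∃ Θ : (Fin 4 → ℝ) → ℝ, ContDiffOn ℝ (⊤ : ℕ∞) Θ U ∧
      ∀ x ∈ U, ∀ i j : Fin 4, i ≠ j →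
        w i j x = pd i (fun y => pd j Θ y) x := by
  choose A hA hA' using fun i => exists_primitive_off_coordinate hUo hUc i (hsmooth i)
    fun x hx j hj k hk => by
      rcases eq_or_ne j k with rfl | hjk
      · rfl
      · exact hcompat i j k hj.symm hk.symm hjk x hx
  obtain ⟨Θ, hΘ, hΘ'⟩ := exists_contDiffOn_primitive hUo hUc hA fun x hx j k => by
    rcases eq_or_ne j k with rfl | hjk
    · rfl
    · rw [hA' j x hx k hjk.symm, hA' k x hx j hjk, hsymm]
  refine ⟨Θ, hΘ, fun x hx i j hij => ?_⟩
  have hloc : (fun y => pd j Θ y) =ᶠ[𝓝 x] A j := by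
    filter_upwards [hUo.mem_nhds hx] with y hy
    exact hΘ' y hy j
  rw [pd, hloc.fderiv_eq, hA' j x hx i hij, hsymm]
end

section
/- Let u_{ij} (1 ≤ i < j ≤ 4) be complex numbers satisfying the general heavenly relation (λ₃−λ₂)(λ₄−λ₁)u₂₃u₁₄ − (λ₃−λ₁)(λ₄−λ₂)u₁₃u₂₄ + (λ₂−λ₁)(λ₄−λ₃)u₁₂u₃₄ = 0 for pairwise distinct λ₁,…,λ₄. Define the symmetric 4×4 matrix γ with entries γ^{ij} = ε^{ijkp}(λ_i−λ_j)(λ_k−λ_p) u_{kp} for i ≠ j (where {k,p} is the complement of {i,j} in {1,2,3,4} and ε is the Levi-Civita symbol) and γ^{ii} = 0, and the symmetric matrix g with g_{ii} = 2G u_{ij}u_{ik}u_{ip} and g_{kp} = G u_{kp}(u_{ik}u_{jp} + u_{ip}u_{jk}) for {i,j,k,p} = {1,2,3,4}, where G = (λ_i−λ_j)(λ_k−λ_p)/(u_{ik}u_{jp} − u_{ip}u_{jk}). Then the matrix product g·γ is a scalar multiple of the identity matrix. -/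
/-- The Levi-Civita symbol `ε^{ijkp}` on four indices, as a complex number. -/
noncomputable def eps (i j k p : Fin 4) : ℂ :=
  if h : Function.Bijective ![i, j, k, p] then
    ((Equiv.Perm.sign (Equiv.ofBijective ![i, j, k, p] h) : ℤ) : ℂ)
  else 0

theorem eps_of_perm (σ : Equiv.Perm (Fin 4)) {i j k p : Fin 4} (h : ![i, j, k, p] = σ) :
    eps i j k p = ((Equiv.Perm.sign σ : ℤ) : ℂ) := by
  have hb : Function.Bijective ![i, j, k, p] := h ▸ σ.bijective
  have he : Equiv.ofBijective ![i, j, k, p] hb = σ := Equiv.ext fun m => congrFun h m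
  rw [eps, dif_pos hb, he]

/-- The general heavenly relation makes the prefactor `G` of the Gindikin metric independent of
the labelling of the four indices. -/
theorem exists_common_prefactor (l : Fin 4 → ℂ)
    (u : Fin 4 → Fin 4 → ℂ) (husymm : ∀ i j, u i j = u j i)
    (hden : u 0 2 * u 1 3 - u 0 3 * u 1 2 ≠ 0)
    (hGHE : (l 2 - l 1) * (l 3 - l 0) * u 1 2 * u 0 3 -
            (l 2 - l 0) * (l 3 - l 1) * u 0 2 * u 1 3 +
            (l 1 - l 0) * (l 3 - l 2) * u 0 1 * u 2 3 = 0) :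
    ∃ G : ℂ, ∀ i j k p : Fin 4, Function.Bijective ![i, j, k, p] →
      (l i - l j) * (l k - l p) = G * (u i k * u j p - u i p * u j k) := by
  obtain ⟨G, ha⟩ : ∃ G, (l 0 - l 1) * (l 2 - l 3) = G * (u 0 2 * u 1 3 - u 0 3 * u 1 2) :=
    ⟨_, (div_mul_cancel₀ _ hden).symm⟩
  have hb : (l 0 - l 2) * (l 1 - l 3) = G * (u 0 1 * u 2 3 - u 0 3 * u 1 2) := by
    apply mul_right_cancel₀ hden
    linear_combination (u 0 1 * u 2 3 - u 0 3 * u 1 2) * ha - hGHE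
  have hc : (l 0 - l 3) * (l 1 - l 2) = G * (u 0 1 * u 2 3 - u 0 2 * u 1 3) := by
    linear_combination hb - ha
  have s10 := husymm 1 0
  have s20 := husymm 2 0
  have s30 := husymm 3 0
  have s21 := husymm 2 1
  have s31 := husymm 3 1
  have s32 := husymm 3 2
  refine ⟨G, fun i j k p h => ?_⟩
  fin_cases i <;> fin_cases j <;> fin_cases k <;> fin_cases p <;>
    first
    | exact absurd h (by decide)
    | (simp only [Fin.zero_eta, Fin.mk_one, Fin.reduceFinMk, s10, s20, s30, s21, s31, s32]
       first
       | linear_combination ha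
       | linear_combination -ha
       | linear_combination hb
       | linear_combination -hb
       | linear_combination hc
       | linear_combination -hc)

/-- The Gindikin metric `g` built from a solution `u_{ij}` of the general heavenly relation is,
up to a scalar factor, the inverse of the symbol bivector `γ^{ij}` of the linearization:
`g·γ` is a scalar multiple of the identity. -/
theorem stmt9 (l : Fin 4 → ℂ) (hl : Function.Injective l)
    (u : Fin 4 → Fin 4 → ℂ) (husymm : ∀ i j, u i j = u j i)
    (hune : ∀ i j, i ≠ j → u i j ≠ 0)
    (hden : ∀ i j k p : Fin 4, Function.Bijective ![i, j, k, p] →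
      u i k * u j p - u i p * u j k ≠ 0)
    (hGHE : (l 2 - l 1) * (l 3 - l 0) * u 1 2 * u 0 3 -
            (l 2 - l 0) * (l 3 - l 1) * u 0 2 * u 1 3 +
            (l 1 - l 0) * (l 3 - l 2) * u 0 1 * u 2 3 = 0)
    (γ g : Matrix (Fin 4) (Fin 4) ℂ)
    (hγdiag : ∀ i, γ i i = 0)
    (hγ : ∀ i j k p : Fin 4, Function.Bijective ![i, j, k, p] →
      γ i j = eps i j k p * (l i - l j) * (l k - l p) * u k p)
    (hg : ∀ i j k p : Fin 4, Function.Bijective ![i, j, k, p] →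
      g i i = 2 * ((l i - l j) * (l k - l p) / (u i k * u j p - u i p * u j k)) *
                (u i j * u i k * u i p) ∧
      g k p = ((l i - l j) * (l k - l p) / (u i k * u j p - u i p * u j k)) *
                (u k p * (u i k * u j p + u i p * u j k))) :
    ∃ c : ℂ, g * γ = c • (1 : Matrix (Fin 4) (Fin 4) ℂ) := by
  obtain ⟨G, hG⟩ := exists_common_prefactor l u husymm (hden 0 1 2 3 (by decide)) hGHE
  have hg_diag : ∀ i j k p : Fin 4, Function.Bijective ![i, j, k, p] →
      g i i = 2 * G * (u i j * u i k * u i p) := by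
    intro i j k p h
    rw [(hg i j k p h).1, hG i j k p h, mul_div_cancel_right₀ _ (hden i j k p h)]
  have hg_off : ∀ i j k p : Fin 4, Function.Bijective ![i, j, k, p] →
      g k p = G * (u k p * (u i k * u j p + u i p * u j k)) := by
    intro i j k p h
    rw [(hg i j k p h).2, hG i j k p h, mul_div_cancel_right₀ _ (hden i j k p h)]
  have hγ_even : ∀ (σ : Equiv.Perm (Fin 4)) (i j k p : Fin 4), ![i, j, k, p] = σ →
      Equiv.Perm.sign σ = 1 → γ i j = G * (u i k * u j p - u i p * u j k) * u k p := by
    intro σ i j k p h hσ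
    have hb : Function.Bijective ![i, j, k, p] := h ▸ σ.bijective
    rw [hγ i j k p hb, eps_of_perm σ h, hσ, ← hG i j k p hb]
    simp
  have g00 := hg_diag 0 1 2 3 (by decide)
  have g11 := hg_diag 1 0 2 3 (by decide)
  have g22 := hg_diag 2 0 1 3 (by decide)
  have g33 := hg_diag 3 0 1 2 (by decide)
  have g01 := hg_off 2 3 0 1 (by decide)
  have g02 := hg_off 1 3 0 2 (by decide)
  have g03 := hg_off 1 2 0 3 (by decide)
  have g10 := hg_off 2 3 1 0 (by decide)
  have g12 := hg_off 0 3 1 2 (by decide)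
  have g13 := hg_off 0 2 1 3 (by decide)
  have g20 := hg_off 1 3 2 0 (by decide)
  have g21 := hg_off 0 3 2 1 (by decide)
  have g23 := hg_off 0 1 2 3 (by decide)
  have g30 := hg_off 1 2 3 0 (by decide)
  have g31 := hg_off 0 2 3 1 (by decide)
  have g32 := hg_off 0 1 3 2 (by decide)
  have γ01 := hγ_even 1 0 1 2 3 (by decide) (by decide)
  have γ02 := hγ_even (Equiv.swap 1 2 * Equiv.swap 2 3) 0 2 3 1 (by decide) (by decide)
  have γ03 := hγ_even (Equiv.swap 1 3 * Equiv.swap 2 3) 0 3 1 2 (by decide) (by decide)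
  have γ10 := hγ_even (Equiv.swap 0 1 * Equiv.swap 2 3) 1 0 3 2 (by decide) (by decide)
  have γ12 := hγ_even (Equiv.swap 0 1 * Equiv.swap 1 2) 1 2 0 3 (by decide) (by decide)
  have γ13 := hγ_even (Equiv.swap 0 1 * Equiv.swap 1 3) 1 3 2 0 (by decide) (by decide)
  have γ20 := hγ_even (Equiv.swap 0 2 * Equiv.swap 1 2) 2 0 1 3 (by decide) (by decide)
  have γ21 := hγ_even (Equiv.swap 0 2 * Equiv.swap 2 3) 2 1 3 0 (by decide) (by decide)
  have γ23 := hγ_even (Equiv.swap 0 2 * Equiv.swap 1 3) 2 3 0 1 (by decide) (by decide)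
  have γ30 := hγ_even (Equiv.swap 0 3 * Equiv.swap 1 3) 3 0 2 1 (by decide) (by decide)
  have γ31 := hγ_even (Equiv.swap 0 3 * Equiv.swap 2 3) 3 1 0 2 (by decide) (by decide)
  have γ32 := hγ_even (Equiv.swap 0 3 * Equiv.swap 1 2) 3 2 1 0 (by decide) (by decide)
  have s10 := husymm 1 0
  have s20 := husymm 2 0
  have s30 := husymm 3 0
  have s21 := husymm 2 1
  have s31 := husymm 3 1
  have s32 := husymm 3 2
  refine ⟨G ^ 2 * (u 0 1 * u 2 3 * ((u 0 2 * u 1 3) ^ 2 - (u 0 3 * u 1 2) ^ 2)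
    - u 0 2 * u 1 3 * ((u 0 1 * u 2 3) ^ 2 - (u 0 3 * u 1 2) ^ 2)
    + u 0 3 * u 1 2 * ((u 0 1 * u 2 3) ^ 2 - (u 0 2 * u 1 3) ^ 2)), ?_⟩
  ext i j
  fin_cases i <;> fin_cases j <;>
    simp [Matrix.mul_apply, Fin.sum_univ_four, hγdiag,
      g00, g01, g02, g03, g10, g11, g12, g13, g20, g21, g22, g23, g30, g31, g32, g33,
      γ01, γ02, γ03, γ10, γ12, γ13, γ20, γ21, γ23, γ30, γ31, γ32,
      s10, s20, s30, s21, s31, s32] <;> ring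
end
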